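/- Let E be an n×r real matrix and C a q×n real matrix. There exists an n×q real matrix H satisfying H·(C·E) = E (equivalently, (H·C − I)·E = 0) if and only if rank(C·E) = rank(E). -/

import Mathlib

open Matrix

namespace Matrix

variable {K l m n : Type*} [Field K] [Fintype m] [Fintype n]

theorem ker_mulVecLin_domRestrict_range_eq_bot {C : Matrix l m K} {E : Matrix m n K}
    (h : (C * E).rank = E.rank) :
    LinearMap.ker (C.mulVecLin.domRestrict (LinearMap.range E.mulVecLin)) = ⊥ := by
  have hrank : Module.finrank K
      (LinearMap.range (C.mulVecLin.domRestrict (LinearMap.range E.mulVecLin))) =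
        Module.finrank K (LinearMap.range E.mulVecLin) := by
    rw [LinearMap.range_domRestrict, ← LinearMap.range_comp, ← mulVecLin_mul]
    exact h
  have hsum := LinearMap.finrank_range_add_finrank_ker
    (C.mulVecLin.domRestrict (LinearMap.range E.mulVecLin))
  exact Submodule.finrank_eq_zero.mp (by omega)

theorem exists_mul_mul_eq_iff_rank_mul_eq [Fintype l] {C : Matrix l m K} {E : Matrix m n K} :
    (∃ H : Matrix m l K, H * (C * E) = E) ↔ (C * E).rank = E.rank := by
  classical
  constructor
  · rintro ⟨H, hH⟩
    refine le_antisymm (rank_mul_le_right C E) ?_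
    simpa only [hH] using rank_mul_le_right H (C * E)
  · intro h
    obtain ⟨L, hL⟩ := LinearMap.exists_leftInverse_of_injective _
      (ker_mulVecLin_domRestrict_range_eq_bot h)
    refine ⟨LinearMap.toMatrix' ((LinearMap.range E.mulVecLin).subtype ∘ₗ L), ?_⟩
    refine ext_of_mulVec_single fun j => ?_
    rw [← mulVec_mulVec, ← mulVec_mulVec, LinearMap.toMatrix'_mulVec]
    exact congrArg Subtype.val
      (LinearMap.congr_fun hL ⟨E *ᵥ Pi.single j 1, LinearMap.mem_range_self E.mulVecLin _⟩)

end Matrix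

/-- There exists an `n×q` matrix `H` with `H·(C·E) = E` (equivalently
`(H·C − I)·E = 0`) if and only if `rank(C·E) = rank(E)`. -/
theorem uio_condition_solvable_iff_rank
    {n r q : ℕ}
    (E : Matrix (Fin n) (Fin r) ℝ)
    (C : Matrix (Fin q) (Fin n) ℝ) :
    (∃ H : Matrix (Fin n) (Fin q) ℝ, H * (C * E) = E ∧ (H * C - 1) * E = 0) ↔
      (C * E).rank = E.rank := by
  rw [← exists_mul_mul_eq_iff_rank_mul_eq]
  refine exists_congr fun H => and_iff_left_of_imp fun hH => ?_
  rw [Matrix.sub_mul, Matrix.one_mul, Matrix.mul_assoc, hH, sub_self]
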